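/- arXiv:1311.5803 — 2 statements merged into one kernel-verified Lean document; each statement's English description precedes it below -/
import Mathlib

section
/- Let C be a based complex of R-modules with a Morse matching M, let t = d − d̃ and let h̃ be the associated degree-1 map on C̃. Then for x ∈ C_α with α ∈ M⁰ ∩ I_n, the perturbed differential obtained from the perturbation lemma is given in closed form by Σ_{i≥0} f̃ t (h̃t)^i (x) = Σ_{β ∈ M⁰ ∩ I_{n−1}} Γ_{β,α}(x), where Γ_{β,α} is the sum over all directed paths from α to β in the Morse graph of the associated path maps. -/
noncomputable section
attribute [local instance] Classical.propDecidable

open DirectSum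

universe u v w

/-- Directed paths in a digraph on `ι` with edge relation `E`. -/
inductive MPath {ι : Type v} (E : ι → ι → Prop) : ι → ι → Type v
  | nil (α : ι) : MPath E α α
  | cons {α β γ : ι} : E α β → MPath E β γ → MPath E α γ

section Morse

variable (R : Type u) [Ring R] (ι : Type v) [DecidableEq ι]
  (V : ι → Type w) [∀ α, AddCommGroup (V α)] [∀ α, Module R (V α)]

/-- The linear endomorphism of `⨁ α, V α` with components `D α β : V α →ₗ[R] V β`
(by convention `0` on summands whose family of components has infinite support). -/
def toLin (D : ∀ α β, V α →ₗ[R] V β) : (⨁ α, V α) →ₗ[R] ⨁ α, V α :=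
  DirectSum.toModule R ι _ fun α =>
    if h : {β | D α β ≠ 0}.Finite then
      ∑ β ∈ h.toFinset, (DirectSum.lof R ι V β).comp (D α β)
    else 0

/-- `(deg, V, D)` is a based complex: the components `D α β : C_α → C_β` of the
differential lower degree by one, each column is finite, and the total
differential squares to zero. -/
structure IsBasedComplex (deg : ι → ℤ) (D : ∀ α β, V α →ₗ[R] V β) : Prop where
  deg_cond : ∀ α β, deg β ≠ deg α - 1 → D α β = 0
  fin : ∀ α, {β | D α β ≠ 0}.Finite
  dsq : toLin R ι V D ∘ₗ toLin R ι V D = 0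

/-- Edges of the Morse graph `G^M(C)`: edges of `G(C)` not in `M` together with
the reversals of the edges in `M`. -/
def MorseEdge (D : ∀ α β, V α →ₗ[R] V β) (M : Set (ι × ι)) (α β : ι) : Prop :=
  (D α β ≠ 0 ∧ (α, β) ∉ M) ∨ (β, α) ∈ M

/-- `M` is a Morse matching on the based complex `(deg, V, D)`. -/
structure IsMorseMatching (deg : ι → ℤ) (D : ∀ α β, V α →ₗ[R] V β)
    (M : Set (ι × ι)) : Prop where
  edge : ∀ e ∈ M, D e.1 e.2 ≠ 0
  iso : ∀ e ∈ M, Function.Bijective (D e.1 e.2)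
  matching : ∀ e ∈ M, ∀ e' ∈ M,
    e.1 = e'.1 ∨ e.1 = e'.2 ∨ e.2 = e'.1 ∨ e.2 = e'.2 → e = e'
  wf : ∃ r : ι → ι → Prop, WellFounded r ∧ (∀ a b c, r a b → r b c → r a c) ∧
    ∀ α β γ, deg γ = deg α →
      MorseEdge R ι V D M α β → MorseEdge R ι V D M β γ → r γ α

end Morse

/-- The set `M⁰` of vertices not incident to any edge of `M`. -/
def MZero {ι : Type v} (M : Set (ι × ι)) : Set ι := {α | ∀ β, (α, β) ∉ M ∧ (β, α) ∉ M}

section Morse2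

variable (R : Type u) [Ring R] (ι : Type v) [DecidableEq ι]
  (V : ι → Type w) [∀ α, AddCommGroup (V α)] [∀ α, Module R (V α)]

/-- The differential `d̃` of `C̃`, keeping only the components of edges in `M`. -/
def dTilde (D : ∀ α β, V α →ₗ[R] V β) (M : Set (ι × ι)) :
    (⨁ α, V α) →ₗ[R] ⨁ α, V α :=
  toLin R ι V fun α β => if (α, β) ∈ M then D α β else 0

/-- The degree one map `h̃`, sending `x ∈ C_α` to `-d⁻¹_{α,β} x` when `β → α ∈ M`. -/
def hTilde (D : ∀ α β, V α →ₗ[R] V β) (M : Set (ι × ι)) :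
    (⨁ α, V α) →ₗ[R] ⨁ α, V α :=
  DirectSum.toModule R ι _ fun α =>
    if h : ∃ β, (β, α) ∈ M ∧ Function.Bijective (D β α) then
      -((DirectSum.lof R ι V h.choose).comp
        (LinearEquiv.ofBijective (D h.choose α) h.choose_spec.2).symm.toLinearMap)
    else 0

/-- The projection `f̃ : C̃ → C̃^M`. -/
def fTilde (M : Set (ι × ι)) : (⨁ α, V α) →ₗ[R] ⨁ s : MZero M, V s.1 :=
  DirectSum.toModule R ι _ fun α =>
    if h : α ∈ MZero M then
      DirectSum.lof R (MZero M) (fun s => V s.1) ⟨α, h⟩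
    else 0

/-- The inclusion `g̃ : C̃^M → C̃`. -/
def gTilde (M : Set (ι × ι)) : (⨁ s : MZero M, V s.1) →ₗ[R] ⨁ α, V α :=
  DirectSum.toModule R (MZero M) _ fun s => DirectSum.lof R ι V s.1

/-- The map attached to an edge `σ → τ` of the Morse graph: `-d⁻¹_{σ,τ}` if it is
the reversal of an edge of `M`, and the component `d_{τ,σ}` otherwise. -/
def edgeMap (D : ∀ α β, V α →ₗ[R] V β) (M : Set (ι × ι)) (σ τ : ι) :
    V σ →ₗ[R] V τ :=
  if h : (τ, σ) ∈ M ∧ Function.Bijective (D τ σ) then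
    -(LinearEquiv.ofBijective (D τ σ) h.2).symm.toLinearMap
  else D σ τ

/-- The map `C_α → C_β` attached to a directed path in the Morse graph. -/
def pathMap (D : ∀ α β, V α →ₗ[R] V β) (M : Set (ι × ι)) :
    {α β : ι} → MPath (MorseEdge R ι V D M) α β → (V α →ₗ[R] V β)
  | _, _, .nil _ => LinearMap.id
  | _, _, .cons _e p => (pathMap D M p).comp (edgeMap R ι V D M _ _)

/-- `Γ_{β,α} : C_α → C_β`, the sum over all directed paths from `α` to `β` in the
Morse graph of the associated path maps. -/
def Gamma (D : ∀ α β, V α →ₗ[R] V β) (M : Set (ι × ι)) (α β : ι) :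
    V α →ₗ[R] V β :=
  ∑ᶠ p : MPath (MorseEdge R ι V D M) α β, pathMap R ι V D M p

end Morse2

section Paths

variable {ι : Type v} {E : ι → ι → Prop}

/-- Paths between distinct vertices, split according to the first vertex they visit;
`s` is a set of out-neighbours of `α` through which every path to `β` must leave. -/
def MPath.equivSigma {α β : ι} (hαβ : α ≠ β) (s : Finset ι) (hs : ∀ σ ∈ s, E α σ)
    (hs' : ∀ σ, E α σ → MPath E σ β → σ ∈ s) :
    (Σ σ : s, MPath E σ.1 β) ≃ MPath E α β where
  toFun q := .cons (hs _ q.1.2) q.2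
  invFun p := match p with
    | .nil _ => absurd rfl hαβ
    | .cons e q => ⟨⟨_, hs' _ e q⟩, q⟩
  left_inv := by rintro ⟨⟨σ, hσ⟩, q⟩; rfl
  right_inv := by
    intro p
    cases p with
    | nil => exact absurd rfl hαβ
    | cons e q => rfl

end Paths

section MorseTheory

variable {R : Type u} [Ring R] {ι : Type v}
  {V : ι → Type w} [∀ α, AddCommGroup (V α)] [∀ α, Module R (V α)]
  {deg : ι → ℤ} {D : ∀ α β, V α →ₗ[R] V β} {M : Set (ι × ι)}

theorem Gamma_eq_sum {α β : ι} (hαβ : α ≠ β) (s : Finset ι)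
    (hs : ∀ σ ∈ s, MorseEdge R ι V D M α σ)
    (hs' : ∀ σ, MorseEdge R ι V D M α σ → MPath (MorseEdge R ι V D M) σ β → σ ∈ s)
    (hfin : ∀ σ ∈ s, Finite (MPath (MorseEdge R ι V D M) σ β)) :
    Finite (MPath (MorseEdge R ι V D M) α β) ∧
      ∀ x, Gamma R ι V D M α β x =
        ∑ σ ∈ s, Gamma R ι V D M σ β (edgeMap R ι V D M α σ x) := by
  have hfin' : ∀ σ : s, Finite (MPath (MorseEdge R ι V D M) σ.1 β) := fun σ => hfin _ σ.2
  let e := MPath.equivSigma hαβ s hs hs'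
  refine ⟨Finite.of_equiv _ e, fun x => ?_⟩
  have (σ : s) : Fintype (MPath (MorseEdge R ι V D M) σ.1 β) := Fintype.ofFinite _
  rw [Gamma, ← finsum_comp_equiv e, finsum_eq_sum_of_fintype, Fintype.sum_sigma,
    LinearMap.sum_apply, ← Finset.sum_coe_sort s]
  refine Finset.sum_congr rfl fun σ _ => ?_
  rw [Gamma, finsum_eq_sum_of_fintype, LinearMap.sum_apply, LinearMap.sum_apply]
  rfl

theorem Gamma_self_apply {β : ι} (h : ∀ p : MPath (MorseEdge R ι V D M) β β, p = .nil β)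
    (x : V β) : Gamma R ι V D M β β x = x := by
  rw [Gamma, finsum_eq_single _ (.nil β) fun p hp => absurd (h p) hp]
  rfl

theorem IsMorseMatching.source_unique (hM : IsMorseMatching R ι V deg D M) {γ γ' σ : ι}
    (h : (γ, σ) ∈ M) (h' : (γ', σ) ∈ M) : γ = γ' :=
  congrArg Prod.fst (hM.matching _ h _ h' (by simp))

variable [DecidableEq ι]

theorem toLin_lof {D' : ∀ α β, V α →ₗ[R] V β} {α : ι} (s : Finset ι)
    (hs : ∀ β, D' α β ≠ 0 → β ∈ s) (x : V α) :
    toLin R ι V D' (lof R ι V α x) = ∑ β ∈ s, lof R ι V β (D' α β x) := by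
  have h : {β | D' α β ≠ 0}.Finite := s.finite_toSet.subset fun β hβ => hs β hβ
  rw [toLin, toModule_lof, dif_pos h, LinearMap.sum_apply]
  refine Finset.sum_subset (fun β hβ => hs β (by simpa using hβ)) fun β _ hβ => ?_
  have h0 : D' α β = 0 := by simpa using hβ
  simp [h0]

theorem fTilde_apply (y : ⨁ α, V α) (u : MZero M) :
    fTilde R ι V M y u = y u.1 := by
  have h : component R (MZero M) (fun s => V s.1) u ∘ₗ fTilde R ι V M =
      component R ι V u.1 := by
    refine DirectSum.linearMap_ext R fun α => LinearMap.ext fun x => ?_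
    simp only [LinearMap.comp_apply, fTilde, toModule_lof]
    by_cases hα : α ∈ MZero M
    · rw [dif_pos hα]
      by_cases hu : u = ⟨α, hα⟩
      · subst hu
        rw [component.lof_self, component.lof_self]
      · rw [component.of, component.of, dif_neg (Ne.symm hu), dif_neg]
        exact fun h => hu (Subtype.ext h.symm)
    · rw [dif_neg hα, component.of, dif_neg]
      · simp
      · rintro rfl
        exact hα u.2
  exact LinearMap.congr_fun h y

theorem finsum_mem_lof_apply {κ : Type*} [DecidableEq κ] {W : κ → Type*}
    [∀ k, AddCommGroup (W k)] [∀ k, Module R (W k)] (y : ⨁ k, W k) (s : Set κ)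
    (hs : ∀ k ∉ s, y k = 0) : ∑ᶠ k ∈ s, lof R κ W k (y k) = y := by
  have h (k : κ) : ∑ᶠ _ : k ∈ s, lof R κ W k (y k) = lof R κ W k (y k) := by
    by_cases hk : k ∈ s
    · simp [hk]
    · simp [hk, hs k hk]
  rw [finsum_congr h, finsum_eq_sum_of_support_subset (s := DFinsupp.support y)]
  · exact DirectSum.sum_support_of y
  · intro k hk
    rw [Finset.mem_coe, DFinsupp.mem_support_iff]
    intro h0
    exact hk (by simp [h0])

namespace IsMorseMatching

theorem deg_eq (hC : IsBasedComplex R ι V deg D) (hM : IsMorseMatching R ι V deg D M)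
    {γ σ : ι} (h : (γ, σ) ∈ M) : deg σ = deg γ - 1 := by
  by_contra hd
  exact hM.edge _ h (hC.deg_cond _ _ hd)

theorem not_target_of_source (hM : IsMorseMatching R ι V deg D M)
    (hC : IsBasedComplex R ι V deg D) {γ σ : ι} (h : (γ, σ) ∈ M) (β : ι) : (β, γ) ∉ M := by
  intro h'
  have := hM.matching _ h _ h' (by simp)
  have h1 := hM.deg_eq hC h
  simp only [Prod.mk.injEq] at this
  rw [this.2] at h1
  omega

theorem hTilde_lof_of_mem (hM : IsMorseMatching R ι V deg D M) {γ σ : ι}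
    (h : (γ, σ) ∈ M) (y : V σ) :
    hTilde R ι V D M (lof R ι V σ y) = lof R ι V γ (edgeMap R ι V D M σ γ y) := by
  have hex : ∃ β, (β, σ) ∈ M ∧ Function.Bijective (D β σ) := ⟨γ, h, hM.iso _ h⟩
  have hγ : hex.choose = γ := hM.source_unique hex.choose_spec.1 h
  rw [hTilde, toModule_lof, dif_pos hex]
  have key : ∀ δ (hδ : (δ, σ) ∈ M ∧ Function.Bijective (D δ σ)), δ = γ →
      (-((lof R ι V δ).comp
        (LinearEquiv.ofBijective (D δ σ) hδ.2).symm.toLinearMap)) y =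
      lof R ι V γ (edgeMap R ι V D M σ γ y) := by
    rintro δ hδ rfl
    rw [edgeMap, dif_pos hδ]
    simp
  exact key _ hex.choose_spec hγ

theorem hTilde_lof_of_notMem {σ : ι} (h : ∀ γ, (γ, σ) ∉ M) (y : V σ) :
    hTilde R ι V D M (lof R ι V σ y) = 0 := by
  rw [hTilde, toModule_lof, dif_neg (fun ⟨γ, hγ⟩ => h γ hγ.1), LinearMap.zero_apply]

/-- A path ending in an unmatched vertex cannot gain degree, and loses some if it leaves a
vertex that is not the target of an edge of `M`. -/
theorem deg_le_of_path (hC : IsBasedComplex R ι V deg D)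
    (hM : IsMorseMatching R ι V deg D M) {σ β : ι}
    (p : MPath (MorseEdge R ι V D M) σ β) (hβ : β ∈ MZero M) :
    deg β ≤ deg σ ∧ (σ ≠ β → (∀ γ, (γ, σ) ∉ M) → deg β ≤ deg σ - 1) := by
  induction p with
  | nil => exact ⟨le_rfl, fun h => absurd rfl h⟩
  | @cons σ τ β e p ih =>
    have ih := ih hβ
    rcases e with ⟨hD, _⟩ | hτ
    · have hd : deg τ = deg σ - 1 := by
        by_contra hd
        exact hD (hC.deg_cond _ _ hd)
      have := ih.1
      exact ⟨by omega, fun _ _ => by omega⟩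
    · have hd := hM.deg_eq hC hτ
      have hne : τ ≠ β := by
        rintro rfl
        exact (hβ σ).1 hτ
      have := ih.2 hne (hM.not_target_of_source hC hτ)
      exact ⟨by omega, fun _ h => absurd hτ (h τ)⟩

/-- Between vertices of equal degree, a path ending in an unmatched vertex can only start
with the reversal of an edge of `M`. -/
theorem mem_of_edge_of_path (hC : IsBasedComplex R ι V deg D)
    (hM : IsMorseMatching R ι V deg D M) {σ τ β : ι} (hβ : β ∈ MZero M)
    (hd : deg σ = deg β) (e : MorseEdge R ι V D M σ τ)
    (p : MPath (MorseEdge R ι V D M) τ β) : (τ, σ) ∈ M := by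
  rcases e with ⟨hD, _⟩ | hτ
  · have hd' : deg τ = deg σ - 1 := by
      by_contra hd
      exact hD (hC.deg_cond _ _ hd)
    have := (hM.deg_le_of_path hC p hβ).1
    omega
  · exact hτ

theorem path_self_eq_nil (hC : IsBasedComplex R ι V deg D)
    (hM : IsMorseMatching R ι V deg D M) {β : ι} (hβ : β ∈ MZero M)
    (p : MPath (MorseEdge R ι V D M) β β) : p = .nil β := by
  cases p with
  | nil => rfl
  | cons e p => exact absurd (hM.mem_of_edge_of_path hC hβ rfl e p) (hβ _).2

/-- For all sufficiently large `N`, the `N`-th power of `h̃t` kills `C_α` and the components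
of `∑_{i<N} t (h̃t)^i` on `C_α` landing in unmatched summands are given by `Γ`. -/
theorem eventually_component_eq_Gamma (hC : IsBasedComplex R ι V deg D)
    (hM : IsMorseMatching R ι V deg D M)
    (t : (⨁ α, V α) →ₗ[R] ⨁ α, V α) (ht : t = toLin R ι V D - dTilde R ι V D M)
    (α : ι) (hα : ∀ γ, (γ, α) ∉ M) :
    (∀ β ∈ MZero M, deg β = deg α - 1 → Finite (MPath (MorseEdge R ι V D M) α β)) ∧
    ∀ᶠ N in Filter.atTop, ∀ x : V α,
      ((hTilde R ι V D M ∘ₗ t) ^ N) (lof R ι V α x) = 0 ∧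
      ∀ β ∈ MZero M, component R ι V β
          (∑ i ∈ Finset.range N, t (((hTilde R ι V D M ∘ₗ t) ^ i) (lof R ι V α x))) =
        if deg β = deg α - 1 then Gamma R ι V D M α β x else 0 := by
  obtain ⟨r, hwf, -, hr⟩ := hM.wf
  induction α using hwf.induction with
  | _ α ih =>
  set H := hTilde R ι V D M with hH
  set out : Finset ι := (hC.fin α).toFinset.filter fun σ => (α, σ) ∉ M with hout
  have mem_out {σ : ι} : σ ∈ out ↔ D α σ ≠ 0 ∧ (α, σ) ∉ M := by simp [hout]
  have edge_iff {σ : ι} : MorseEdge R ι V D M α σ ↔ σ ∈ out := by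
    rw [mem_out]
    exact or_iff_left (hα σ)
  have deg_out {σ : ι} (hσ : σ ∈ out) : deg σ = deg α - 1 := by
    by_contra hd
    exact (mem_out.1 hσ).1 (hC.deg_cond _ _ hd)
  have t_lof (x : V α) : t (lof R ι V α x) = ∑ σ ∈ out, lof R ι V σ (D α σ x) := by
    rw [ht, LinearMap.sub_apply, dTilde, toLin_lof (hC.fin α).toFinset (by simp),
      toLin_lof (hC.fin α).toFinset, ← Finset.sum_sub_distrib, hout, Finset.sum_filter]
    · refine Finset.sum_congr rfl fun σ _ => ?_
      by_cases h : (α, σ) ∈ M <;> simp [h]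
    · intro β hβ
      by_cases h : (α, β) ∈ M <;> simp_all
  have step {σ γ : ι} (hσ : σ ∈ out) (hγ : (γ, σ) ∈ M) :=
    ih γ (hr α σ γ (by have := hM.deg_eq hC hγ; have := deg_out hσ; omega)
      (edge_iff.2 hσ) (Or.inr hγ)) (hM.not_target_of_source hC hγ)
  have deg_step {σ γ : ι} (hσ : σ ∈ out) (hγ : (γ, σ) ∈ M) : deg γ = deg α := by
    have := hM.deg_eq hC hγ
    have := deg_out hσ
    omega
  have out_paths {σ β : ι} (hσ : σ ∈ out) (hβ : β ∈ MZero M) (hd : deg β = deg α - 1)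
      (hne : σ ≠ β) {γ : ι} (hγ : (γ, σ) ∈ M) :
      Finite (MPath (MorseEdge R ι V D M) σ β) ∧ ∀ y, Gamma R ι V D M σ β y =
        Gamma R ι V D M γ β (edgeMap R ι V D M σ γ y) := by
    simpa using Gamma_eq_sum (R := R) (V := V) (D := D) (M := M) hne {γ}
      (fun τ hτ => by rw [Finset.mem_singleton.1 hτ]; exact Or.inr hγ)
      (fun τ e p => Finset.mem_singleton.2 (hM.source_unique
        (hM.mem_of_edge_of_path hC hβ ((deg_out hσ).trans hd.symm) e p) hγ))
      (fun τ hτ => by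
        rw [Finset.mem_singleton.1 hτ]
        exact (step hσ hγ).1 β hβ (by rw [deg_step hσ hγ, hd]))
  have out_paths_zero {σ β : ι} (hσ : σ ∈ out) (hβ : β ∈ MZero M) (hd : deg β = deg α - 1)
      (hne : σ ≠ β) (hγ : ∀ γ, (γ, σ) ∉ M) :
      Finite (MPath (MorseEdge R ι V D M) σ β) ∧ ∀ y, Gamma R ι V D M σ β y = 0 := by
    simpa using Gamma_eq_sum (R := R) (V := V) (D := D) (M := M) hne ∅ (by simp)
      (fun τ e p => absurd
        (hM.mem_of_edge_of_path hC hβ ((deg_out hσ).trans hd.symm) e p) (hγ τ)) (by simp)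
  have out_finite {σ β : ι} (hσ : σ ∈ out) (hβ : β ∈ MZero M) (hd : deg β = deg α - 1) :
      Finite (MPath (MorseEdge R ι V D M) σ β) := by
    by_cases hne : σ = β
    · subst hne
      have : Subsingleton (MPath (MorseEdge R ι V D M) σ σ) :=
        ⟨fun p q => (hM.path_self_eq_nil hC hβ p).trans (hM.path_self_eq_nil hC hβ q).symm⟩
      infer_instance
    · by_cases hγ : ∃ γ, (γ, σ) ∈ M
      · obtain ⟨γ, hγ⟩ := hγ
        exact (out_paths hσ hβ hd hne hγ).1
      · exact (out_paths_zero hσ hβ hd hne (not_exists.1 hγ)).1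
  have first_step {β : ι} (hβ : β ∈ MZero M) (hd : deg β = deg α - 1) :=
    Gamma_eq_sum (R := R) (V := V) (D := D) (M := M) (α := α) (β := β)
      (by rintro rfl; omega) out (fun σ hσ => edge_iff.2 hσ) (fun σ e _ => edge_iff.1 e)
      (fun σ hσ => out_finite hσ hβ hd)
  refine ⟨fun β hβ hd => (first_step hβ hd).1, ?_⟩
  have hev : ∀ᶠ N in Filter.atTop, ∀ σ ∈ out, ∀ y : V σ,
      ((H ∘ₗ t) ^ N) (H (lof R ι V σ y)) = 0 ∧ ∀ β ∈ MZero M,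
        component R ι V β (lof R ι V σ y +
          ∑ i ∈ Finset.range N, t (((H ∘ₗ t) ^ i) (H (lof R ι V σ y)))) =
        if deg β = deg α - 1 then Gamma R ι V D M σ β y else 0 := by
    rw [Filter.eventually_all_finset]
    intro σ hσ
    have lof_ne {β : ι} (hne : σ ≠ β) (y : V σ) : component R ι V β (lof R ι V σ y) = 0 := by
      rw [component.of, dif_neg hne]
    by_cases hγ : ∃ γ, (γ, σ) ∈ M
    · obtain ⟨γ, hγ⟩ := hγ
      filter_upwards [(step hσ hγ).2] with N hN y
      rw [hM.hTilde_lof_of_mem hγ]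
      refine ⟨(hN _).1, fun β hβ => ?_⟩
      have hne : σ ≠ β := by
        rintro rfl
        exact (hβ γ).2 hγ
      rw [map_add, lof_ne hne, zero_add, (hN _).2 β hβ, deg_step hσ hγ]
      split_ifs with hd
      · exact ((out_paths hσ hβ hd hne hγ).2 y).symm
      · rfl
    · have hγ := not_exists.1 hγ
      refine Filter.Eventually.of_forall fun N y => ?_
      rw [hH, hTilde_lof_of_notMem hγ]
      refine ⟨map_zero _, fun β hβ => ?_⟩
      simp only [map_zero, Finset.sum_const_zero, add_zero]
      by_cases hne : σ = β
      · subst hne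
        rw [if_pos (deg_out hσ), component.lof_self,
          Gamma_self_apply (hM.path_self_eq_nil hC hβ)]
      · rw [lof_ne hne]
        split_ifs with hd
        · exact ((out_paths_zero hσ hβ hd hne hγ).2 y).symm
        · rfl
  rw [← Filter.map_add_atTop_eq_nat 1, Filter.eventually_map]
  filter_upwards [hev] with N hN x
  have pow_lof (i : ℕ) : ((H ∘ₗ t) ^ (i + 1)) (lof R ι V α x) =
      ∑ σ ∈ out, ((H ∘ₗ t) ^ i) (H (lof R ι V σ (D α σ x))) := by
    rw [pow_succ, Module.End.mul_apply, LinearMap.comp_apply, t_lof, map_sum, map_sum]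
  refine ⟨?_, fun β hβ => ?_⟩
  · rw [pow_lof]
    exact Finset.sum_eq_zero fun σ hσ => (hN σ hσ _).1
  · have hsum : ∑ i ∈ Finset.range (N + 1), t (((H ∘ₗ t) ^ i) (lof R ι V α x)) =
        ∑ σ ∈ out, (lof R ι V σ (D α σ x) +
          ∑ i ∈ Finset.range N, t (((H ∘ₗ t) ^ i) (H (lof R ι V σ (D α σ x))))) := by
      rw [Finset.sum_range_succ', pow_zero, Module.End.one_apply, t_lof,
        Finset.sum_add_distrib, Finset.sum_comm, add_comm]
      simp only [pow_lof, map_sum]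
    rw [hsum, map_sum, Finset.sum_congr rfl fun σ hσ => (hN σ hσ _).2 β hβ]
    split_ifs with hd
    · rw [(first_step hβ hd).2]
      refine Finset.sum_congr rfl fun σ _ => ?_
      rw [edgeMap, dif_neg fun h => hα σ h.1]
    · exact Finset.sum_const_zero

end IsMorseMatching

end MorseTheory

theorem perturbed_differential_closed_form
    (R : Type u) [Ring R] (ι : Type v) [DecidableEq ι]
    (V : ι → Type w) [∀ α, AddCommGroup (V α)] [∀ α, Module R (V α)]
    (deg : ι → ℤ) (D : ∀ α β, V α →ₗ[R] V β) (M : Set (ι × ι))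
    (hC : IsBasedComplex R ι V deg D) (hM : IsMorseMatching R ι V deg D M)
    (t : (⨁ α, V α) →ₗ[R] ⨁ α, V α)
    (ht : t = toLin R ι V D - dTilde R ι V D M)
    (α : ι) (hα : α ∈ MZero M) (x : V α) :
    ∑ᶠ i : ℕ, fTilde R ι V M
        (t (((hTilde R ι V D M ∘ₗ t) ^ i) (DirectSum.lof R ι V α x))) =
      ∑ᶠ u ∈ {u : MZero M | deg u.1 = deg α - 1},
        DirectSum.lof R (MZero M) (fun s : MZero M => V s.1) u
          (Gamma R ι V D M α u.1 x) := by
  obtain ⟨N, hN⟩ := (hM.eventually_component_eq_Gamma hC t ht α fun γ => (hα γ).2).2.exists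
  obtain ⟨hzero, hcomp⟩ := hN x
  have hlhs : ∑ᶠ i : ℕ, fTilde R ι V M
      (t (((hTilde R ι V D M ∘ₗ t) ^ i) (lof R ι V α x))) =
      fTilde R ι V M (∑ i ∈ Finset.range N,
        t (((hTilde R ι V D M ∘ₗ t) ^ i) (lof R ι V α x))) := by
    rw [map_sum]
    refine finsum_eq_sum_of_support_subset _ fun i hi => ?_
    by_contra hiN
    obtain ⟨k, rfl⟩ := Nat.exists_eq_add_of_le' (by simpa using hiN : N ≤ i)
    refine hi ?_
    beta_reduce
    rw [pow_add, Module.End.mul_apply, hzero, map_zero, map_zero, map_zero]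
  rw [hlhs]
  set y := ∑ i ∈ Finset.range N, t (((hTilde R ι V D M ∘ₗ t) ^ i) (lof R ι V α x))
  have hy (u : MZero M) : fTilde R ι V M y u =
      if deg u.1 = deg α - 1 then Gamma R ι V D M α u.1 x else 0 :=
    (fTilde_apply y u).trans (hcomp u.1 u.2)
  rw [← finsum_mem_lof_apply (R := R) (fTilde R ι V M y) {u : MZero M | deg u.1 = deg α - 1}
    fun u hu => (hy u).trans (if_neg hu)]
  refine finsum_mem_congr rfl fun u hu => ?_
  rw [hy, if_pos (show deg u.1 = deg α - 1 from hu)]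
end
end

section
/- Let (D, C, f, g, h) be a contraction of chain complexes of R-modules, let t be a perturbation of C such that ht is locally nilpotent, and set S = Σ_{n≥0} t(ht)^n, f' = f + fSh, g' = g + hSg, h' = h + hSh, t' = fSg. Then g'f' = 1 + (d_C + t)h' + h'(d_C + t), f'h' = 0, h'g' = 0 and h'² = 0. -/
noncomputable section

open DirectSum

universe u v

section Perturbation

variable (R : Type u) [Ring R]

/-- A linear map between the total modules of two `ℤ`-graded modules has
degree `k` if all its components outside degree `k` vanish. -/
def HasDeg (A B : ℤ → Type v)
    [∀ n, AddCommGroup (A n)] [∀ n, Module R (A n)]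
    [∀ n, AddCommGroup (B n)] [∀ n, Module R (B n)]
    (F : (⨁ n, A n) →ₗ[R] ⨁ n, B n) (k : ℤ) : Prop :=
  ∀ m n : ℤ, n ≠ m + k →
    DirectSum.component R ℤ B n ∘ₗ F ∘ₗ DirectSum.lof R ℤ A m = 0

/-- `(D, C, f, g, h)` is a contraction of chain complexes: `dC` and `dD` are the
(degree `-1`, square zero) differentials on the chain complexes `C` and `D` with
underlying graded modules `Cf` and `Df`, `f` and `g` are chain maps, `h` has
degree `1`, and `fg = 1`, `gf = 1 + dh + hd`, `fh = 0`, `hg = 0`, `h² = 0`. -/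
structure IsContraction (Cf Df : ℤ → Type v)
    [∀ n, AddCommGroup (Cf n)] [∀ n, Module R (Cf n)]
    [∀ n, AddCommGroup (Df n)] [∀ n, Module R (Df n)]
    (dC : (⨁ n, Cf n) →ₗ[R] ⨁ n, Cf n) (dD : (⨁ n, Df n) →ₗ[R] ⨁ n, Df n)
    (f : (⨁ n, Cf n) →ₗ[R] ⨁ n, Df n) (g : (⨁ n, Df n) →ₗ[R] ⨁ n, Cf n)
    (h : (⨁ n, Cf n) →ₗ[R] ⨁ n, Cf n) : Prop where
  dC_sq : dC ∘ₗ dC = 0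
  dD_sq : dD ∘ₗ dD = 0
  dC_deg : HasDeg R Cf Cf dC (-1)
  dD_deg : HasDeg R Df Df dD (-1)
  f_deg : HasDeg R Cf Df f 0
  g_deg : HasDeg R Df Cf g 0
  h_deg : HasDeg R Cf Cf h 1
  f_chain : f ∘ₗ dC = dD ∘ₗ f
  g_chain : g ∘ₗ dD = dC ∘ₗ g
  fg : f ∘ₗ g = LinearMap.id
  gf : g ∘ₗ f = LinearMap.id + dC ∘ₗ h + h ∘ₗ dC
  fh : f ∘ₗ h = 0
  hg : h ∘ₗ g = 0
  hh : h ∘ₗ h = 0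

end Perturbation
section LocallyNilpotent

variable {R M : Type*} [Ring R] [AddCommGroup M] [Module R M] {N : Module.End R M}

theorem support_pow_apply_subset {x : M} {m : ℕ} (hm : (N ^ m) x = 0) :
    (Function.support fun n : ℕ => (N ^ n) x) ⊆ Finset.range m := by
  intro n hn
  by_contra hlt
  simp only [Finset.coe_range, Set.mem_Iio, not_lt] at hlt
  exact hn (Module.End.pow_map_zero_of_le hlt hm)

theorem finsum_pow_apply_eq_sum_range {x : M} {m : ℕ} (hm : (N ^ m) x = 0) :
    ∑ᶠ n : ℕ, (N ^ n) x = (∑ n ∈ Finset.range m, N ^ n) x := by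
  rw [finsum_eq_sum_of_support_subset _ (support_pow_apply_subset hm), LinearMap.sum_apply]

theorem finite_support_pow_apply (hN : ∀ x, ∃ n : ℕ, (N ^ n) x = 0) (x : M) :
    (Function.support fun n : ℕ => (N ^ n) x).Finite :=
  (Finset.finite_toSet _).subset (support_pow_apply_subset (hN x).choose_spec)

/-- The geometric series `∑ Nⁿ` of a locally nilpotent endomorphism. -/
def geomSeries (N : Module.End R M) (hN : ∀ x, ∃ n : ℕ, (N ^ n) x = 0) : Module.End R M where
  toFun x := ∑ᶠ n : ℕ, (N ^ n) x
  map_add' x y := by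
    simp only [map_add]
    exact finsum_add_distrib (finite_support_pow_apply hN x) (finite_support_pow_apply hN y)
  map_smul' r x := by
    simp only [map_smul, RingHom.id_apply]
    exact (smul_finsum' r (finite_support_pow_apply hN x)).symm

theorem one_sub_mul_geomSeries (hN : ∀ x, ∃ n : ℕ, (N ^ n) x = 0) :
    (1 - N) * geomSeries N hN = 1 := by
  ext x
  obtain ⟨m, hm⟩ := hN x
  change (1 - N) (∑ᶠ n : ℕ, (N ^ n) x) = x
  rw [finsum_pow_apply_eq_sum_range hm, ← Module.End.mul_apply, mul_neg_geom_sum]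
  simp [hm]

theorem geomSeries_mul_one_sub (hN : ∀ x, ∃ n : ℕ, (N ^ n) x = 0) :
    geomSeries N hN * (1 - N) = 1 := by
  ext x
  obtain ⟨m, hm⟩ := hN x
  have hm' : (N ^ m) ((1 - N) x) = 0 := by
    rw [← Module.End.mul_apply, ← ((Commute.one_left _).sub_left (Commute.self_pow N m)).eq,
      Module.End.mul_apply, hm, map_zero]
  change ∑ᶠ n : ℕ, (N ^ n) ((1 - N) x) = x
  rw [finsum_pow_apply_eq_sum_range hm', ← Module.End.mul_apply, geom_sum_mul_neg]
  simp [hm]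

end LocallyNilpotent

/-- The homotopy identity of the perturbation lemma in a ring, with `P` the inverse of `1 - h t`. -/
theorem perturbed_homotopy_ring_identity {E : Type*} [Ring E] {d t h P : E}
    (hd : d * d = 0) (hdt : (d + t) * (d + t) = 0)
    (hP : P * (1 - h * t) = 1) (hP' : (1 - h * t) * P = 1) :
    P * (1 + d * h + h * d) * (1 + t * P * h) =
      1 + (d + t) * (P * h) + P * h * (d + t) := by
  have hsq : d * t + t * d + t * t = 0 := by
    have : d * t + t * d + t * t = (d + t) * (d + t) - d * d := by noncomm_ring
    rw [this, hdt, hd, sub_zero]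
  have hQ : (1 - t * h) * (1 + t * P * h) = 1 := by
    calc (1 - t * h) * (1 + t * P * h) = 1 - t * h + t * ((1 - h * t) * P) * h := by noncomm_ring
      _ = 1 := by rw [hP']; noncomm_ring
  have hPh : P * h = h * (1 + t * P * h) := by
    calc P * h = (1 - h * t) * P * h + h * t * P * h := by noncomm_ring
      _ = h * (1 + t * P * h) := by rw [hP']; noncomm_ring
  have key : 1 + d * h + h * d =
      (1 - h * t) * (1 - t * h) + (1 - h * t) * (d + t) * h + h * (d + t) * (1 - t * h) := by
    calc 1 + d * h + h * d = 1 + d * h + h * d - h * (d * t + t * d + t * t) * h := by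
          rw [hsq]; noncomm_ring
      _ = _ := by noncomm_ring
  calc P * (1 + d * h + h * d) * (1 + t * P * h)
      = (P * (1 - h * t)) * ((1 - t * h) * (1 + t * P * h))
        + (P * (1 - h * t)) * (d + t) * (h * (1 + t * P * h))
        + P * h * (d + t) * ((1 - t * h) * (1 + t * P * h)) := by
        rw [key]; simp only [mul_add, add_mul, mul_assoc]; abel
    _ = 1 + (d + t) * (P * h) + P * h * (d + t) := by
        rw [hP, hQ, ← hPh]; simp only [one_mul, mul_one]

theorem perturbed_homotopy_identities
    (R : Type u) [Ring R] (Cf Df : ℤ → Type v)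
    [∀ n, AddCommGroup (Cf n)] [∀ n, Module R (Cf n)]
    [∀ n, AddCommGroup (Df n)] [∀ n, Module R (Df n)]
    (dC : (⨁ n, Cf n) →ₗ[R] ⨁ n, Cf n) (dD : (⨁ n, Df n) →ₗ[R] ⨁ n, Df n)
    (f : (⨁ n, Cf n) →ₗ[R] ⨁ n, Df n) (g : (⨁ n, Df n) →ₗ[R] ⨁ n, Cf n)
    (h : (⨁ n, Cf n) →ₗ[R] ⨁ n, Cf n)
    (hcon : IsContraction R Cf Df dC dD f g h)
    (t : (⨁ n, Cf n) →ₗ[R] ⨁ n, Cf n)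
    (ht_deg : HasDeg R Cf Cf t (-1))
    (ht_sq : (dC + t) ∘ₗ (dC + t) = 0)
    (hnil : ∀ x : ⨁ n, Cf n, ∃ n : ℕ, ((h ∘ₗ t) ^ n) x = 0)
    (S : (⨁ n, Cf n) → ⨁ n, Cf n)
    (hS : ∀ x, S x = ∑ᶠ n : ℕ, t (((h ∘ₗ t) ^ n) x))
    (f' : (⨁ n, Cf n) → ⨁ n, Df n)
    (hf' : ∀ x, f' x = f x + f (S (h x)))
    (g' : (⨁ n, Df n) → ⨁ n, Cf n)
    (hg' : ∀ y, g' y = g y + h (S (g y)))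
    (h' : (⨁ n, Cf n) → ⨁ n, Cf n)
    (hh' : ∀ x, h' x = h x + h (S (h x)))
    (t' : (⨁ n, Df n) → ⨁ n, Df n)
    (ht' : ∀ y, t' y = f (S (g y))) :
    -- `g'f' = 1 + (dC + t)h' + h'(dC + t)`
    (∀ x : ⨁ n, Cf n, g' (f' x) = x + (dC (h' x) + t (h' x)) + h' (dC x + t x)) ∧
    -- `f'h' = 0`
    (∀ x : ⨁ n, Cf n, f' (h' x) = 0) ∧
    -- `h'g' = 0`
    (∀ y : ⨁ n, Df n, h' (g' y) = 0) ∧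
    -- `h'² = 0`
    (∀ x : ⨁ n, Cf n, h' (h' x) = 0) := by
  let P : Module.End R (⨁ n, Cf n) := geomSeries (h ∘ₗ t) hnil
  have hP : P * (1 - h * t) = 1 := geomSeries_mul_one_sub hnil
  have hP' : (1 - h * t) * P = 1 := one_sub_mul_geomSeries hnil
  have hSP : ∀ x, S x = t (P x) := fun x =>
    (hS x).trans (t.toAddMonoidHom.map_finsum (finite_support_pow_apply hnil x)).symm
  have hPx : ∀ x, P x = x + h (t (P x)) := fun x =>
    sub_eq_iff_eq_add.mp (LinearMap.congr_fun hP' x)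
  have hh'P : ∀ x, h' x = P (h x) := fun x => by rw [hh', hSP, ← hPx]
  have hg'P : ∀ y, g' y = P (g y) := fun y => by rw [hg', hSP, ← hPx]
  have hh : ∀ x, h (h x) = 0 := LinearMap.congr_fun hcon.hh
  have hfh : ∀ x, f (h x) = 0 := LinearMap.congr_fun hcon.fh
  have hhg : ∀ y, h (g y) = 0 := LinearMap.congr_fun hcon.hg
  have hhP : ∀ x, h (P x) = h x := fun x => by rw [hPx, map_add, hh, add_zero]
  refine ⟨fun x => ?_, fun x => ?_, fun y => ?_, fun x => ?_⟩
  · have hring := perturbed_homotopy_ring_identity hcon.dC_sq ht_sq hP hP'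
    have hgf : g ∘ₗ f = 1 + dC * h + h * dC := hcon.gf
    rw [← hgf] at hring
    rw [hg'P, hf', hSP, hh'P, hh'P, ← map_add]
    exact LinearMap.congr_fun hring x
  · rw [hh'P, hf', hhP, hh, hSP, map_zero, map_zero, map_zero, add_zero, hPx, map_add,
      hfh, hfh, add_zero]
  · rw [hg'P, hh'P, hhP, hhg, map_zero]
  · rw [hh'P, hh'P, hhP, hh, map_zero]
end
end
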